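/- Let 𝒮 be a nonempty compact set of signal matrices with entries in [0,1], suppose C ≥ 0, λ ≥ 0, R ≥ 0 with Σ_{j∈L_i^out} R_{ij} ≤ 1 for every i ∈ L_entry ∪ L_int, and fix ε > 0 and k ≥ 0. Assume there exists a map S^mp assigning to every nonnegative state y an element S^mp(y) ∈ 𝒮 such that ‖f(y,S^mp(y),λ;C,R)‖₂² − ‖y‖₂² ≤ −ε‖y‖₁ + k for every nonnegative state y. Let π be any map assigning to each nonnegative state x a minimizer π(x) ∈ 𝒮 of V(x,·) over 𝒮, and consider the closed-loop trajectory x(t+1) = f(x(t), π(x(t)), λ; C, R). Then there exist a class-KL function β and a constant d ≥ 0 such that ‖x(t)‖₂ ≤ β(‖x(0)‖₂, t) + d for every nonnegative initial state x(0) and every t ≥ 0. -/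

import Mathlib

open Finset

/-- The set of input links of link `i`: those links `k` whose output set contains `i`. -/
def Lin {L : Type*} [Fintype L] [DecidableEq L] (out : L → Finset L) (i : L) : Finset L :=
  Finset.univ.filter (fun k => i ∈ out k)

/-- One-step traffic dynamics `f(x,S,λ;C,R)`, componentwise on movements. -/
noncomputable def fdyn {L : Type*} [Fintype L] [DecidableEq L]
    (Lint : Finset L) (out : L → Finset L)
    (x S C R : L → L → ℝ) (lam : L → ℝ) (i j : L) : ℝ :=
  if i ∈ Lint then
    max (x i j - C i j * S i j) 0 + ∑ k ∈ Lin out i, R i j * min (C k i * S k i) (x k i)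
  else
    max (x i j - C i j * S i j) 0 + R i j * lam i

/-- Augmented dynamics `F(x,S,λ;C,C̃,R)`: the saturation rate appearing with a negative
sign is replaced by `Ct`. -/
noncomputable def Faug {L : Type*} [Fintype L] [DecidableEq L]
    (Lint : Finset L) (out : L → Finset L)
    (x S C Ct R : L → L → ℝ) (lam : L → ℝ) (i j : L) : ℝ :=
  if i ∈ Lint then
    max (x i j - Ct i j * S i j) 0 + ∑ k ∈ Lin out i, R i j * min (C k i * S k i) (x k i)
  else
    max (x i j - Ct i j * S i j) 0 + R i j * lam i

/-- 1-norm of a state over all movements. -/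
noncomputable def norm1 {L : Type*} (Lem : Finset L) (out : L → Finset L)
    (x : L → L → ℝ) : ℝ :=
  ∑ i ∈ Lem, ∑ j ∈ out i, |x i j|

/-- Squared 2-norm of a state over all movements. -/
noncomputable def norm2sq {L : Type*} (Lem : Finset L) (out : L → Finset L)
    (x : L → L → ℝ) : ℝ :=
  ∑ i ∈ Lem, ∑ j ∈ out i, (x i j) ^ 2

/-- 2-norm of a state over all movements. -/
noncomputable def norm2 {L : Type*} (Lem : Finset L) (out : L → Finset L)
    (x : L → L → ℝ) : ℝ :=
  Real.sqrt (norm2sq Lem out x)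

/-- The one-step MPC Lyapunov-type cost `V(x,S)`. -/
noncomputable def Vcost {L : Type*} [Fintype L] [DecidableEq L]
    (Lentry Lint : Finset L) (out : L → Finset L) (eps : ℝ)
    (x S C R : L → L → ℝ) (lam : L → ℝ) : ℝ :=
  eps * norm1 (Lentry ∪ Lint) out x + (∑ i ∈ Lentry, (lam i) ^ 2)
    + ∑ i ∈ Lentry, ∑ j ∈ out i,
        ((x i j) ^ 2 + 2 * R i j * lam i * x i j
          + (C i j) ^ 2 * (S i j) ^ 2 - 2 * C i j * S i j * x i j)
    + ∑ i ∈ Lint, ∑ j ∈ out i, (fdyn Lint out x S C R lam i j) ^ 2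

/-- A class-KL function `β : ℝ≥0 × ℕ → ℝ≥0` (restricted to `s ≥ 0`). -/
def IsClassKL (β : ℝ → ℕ → ℝ) : Prop :=
  (∀ t, ContinuousOn (fun s => β s t) (Set.Ici 0)) ∧
  (∀ t, β 0 t = 0) ∧
  (∀ t, StrictMonoOn (fun s => β s t) (Set.Ici 0)) ∧
  (∀ s t, 0 ≤ s → 0 ≤ β s t) ∧
  (∀ s, 0 < s → StrictAnti (fun t : ℕ => β s t)) ∧
  (∀ s, 0 < s → Filter.Tendsto (fun t : ℕ => β s t) Filter.atTop (nhds 0))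

/-- The function `(s, t) ↦ max (s - δ t) 0 + s / (t + 1)` is of class KL. -/
lemma isClassKL_max_sub_add_div {δ : ℝ} (hδ : 0 < δ) :
    IsClassKL fun s t => max (s - δ * t) 0 + s / (t + 1) := by
  refine ⟨fun t => ?_, fun t => ?_, fun t => ?_, fun s t hs => by positivity,
    fun s hs => ?_, fun s hs => ?_⟩
  · exact Continuous.continuousOn (by fun_prop)
  · have : 0 ≤ δ * t := by positivity
    simp [this]
  · intro a _ b _ hab
    exact add_lt_add_of_le_of_lt (max_le_max_right 0 (by linarith))
      (div_lt_div_of_pos_right hab (by positivity))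
  · intro m n hmn
    have hmn' : (m : ℝ) < n := by exact_mod_cast hmn
    refine add_lt_add_of_le_of_lt (max_le_max_right 0 ?_)
      (div_lt_div_of_pos_left hs (by positivity) (by linarith))
    have := mul_le_mul_of_nonneg_left hmn'.le hδ.le
    linarith
  · have hdiv : Filter.Tendsto (fun t : ℕ => s / ((t : ℝ) + 1)) Filter.atTop (nhds 0) :=
      (tendsto_const_nhds.div_atTop
        (Filter.tendsto_atTop_add_const_right _ 1 tendsto_natCast_atTop_atTop))
    have hmax : Filter.Tendsto (fun t : ℕ => max (s - δ * t) 0) Filter.atTop (nhds 0) := by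
      obtain ⟨N, hN⟩ := exists_nat_ge (s / δ)
      refine tendsto_const_nhds.congr' ?_
      filter_upwards [Filter.eventually_ge_atTop N] with t ht
      have hNt : (N : ℝ) ≤ t := by exact_mod_cast ht
      have := (div_le_iff₀' hδ).1 (hN.trans hNt)
      exact (max_eq_right (by linarith)).symm
    simpa using hmax.add hdiv

/-- A nonnegative sequence whose square drifts down linearly outside a bounded set decreases at a
constant rate until it enters a fixed bounded set. -/
lemma exists_le_max_of_sq_drift {eps K : ℝ} (heps : 0 < eps) (hK : 0 ≤ K) :
    ∃ d, 0 ≤ d ∧ ∀ r : ℕ → ℝ, (∀ t, 0 ≤ r t) →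
      (∀ t, r (t + 1) ^ 2 ≤ r t ^ 2 - eps * r t + K) →
      ∀ t : ℕ, r t ≤ max (r 0 - eps / 4 * t) d := by
  have ha : 0 ≤ 2 * K / eps + eps := by positivity
  have hae : 2 * K / eps * eps = 2 * K := div_mul_cancel₀ _ heps.ne'
  set a := 2 * K / eps + eps
  refine ⟨√(a ^ 2 + K), Real.sqrt_nonneg _, fun r hr hstep t => ?_⟩
  induction t with
  | zero => simp
  | succ t ih =>
    push_cast
    rcases le_total a (r t) with h | h
    · have hdec : r (t + 1) ≤ r t - eps / 4 := by
        have ha' : eps ≤ a := le_add_of_nonneg_left (by positivity)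
        refine (abs_le_of_sq_le_sq' ?_ (by linarith)).2
        nlinarith [hstep t, mul_le_mul_of_nonneg_right h heps.le, sq_nonneg eps]
      rcases le_max_iff.1 ih with h' | h'
      · exact le_max_of_le_left (by linarith)
      · exact le_max_of_le_right (by linarith)
    · refine le_max_of_le_right (Real.le_sqrt_of_sq_le ?_)
      nlinarith [hstep t, hr t, mul_nonneg heps.le (hr t)]

/-- For nonnegative queue `x`, service `c ≤ M` and inflow `b`, the squared next queue differs from
its quadratic surrogate by at most `(b + M) ^ 2`. -/
lemma abs_sq_max_sub_add_sub_le {x c b M : ℝ} (hx : 0 ≤ x) (hc : 0 ≤ c) (hcM : c ≤ M)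
    (hb : 0 ≤ b) :
    |(max (x - c) 0 + b) ^ 2 - (x ^ 2 + 2 * b * x + c ^ 2 - 2 * c * x)| ≤ (b + M) ^ 2 := by
  have hbc := mul_le_mul_of_nonneg_left hcM hb
  have hbc0 := mul_nonneg hb hc
  have hcc := mul_self_le_mul_self hc hcM
  rw [abs_le]
  rcases le_total c x with h | h
  · rw [max_eq_left (by linarith)]
    constructor <;> nlinarith
  · rw [max_eq_right (by linarith)]
    have := mul_le_mul_of_nonneg_left h hb
    have := mul_nonneg hb hx
    have := mul_nonneg hx (sub_nonneg.2 h)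
    have := mul_nonneg hx hc
    constructor <;> nlinarith

lemma norm2sq_nonneg {L : Type*} (A : Finset L) (out : L → Finset L) (x : L → L → ℝ) :
    0 ≤ norm2sq A out x :=
  sum_nonneg fun _ _ => sum_nonneg fun _ _ => sq_nonneg _

lemma norm2_le_norm1 {L : Type*} (A : Finset L) (out : L → Finset L) (x : L → L → ℝ) :
    norm2 A out x ≤ norm1 A out x := by
  have h1 : 0 ≤ norm1 A out x := sum_nonneg fun _ _ => sum_nonneg fun _ _ => abs_nonneg _
  refine Real.sqrt_le_iff.2 ⟨h1, ?_⟩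
  unfold norm2sq norm1
  simp_rw [sum_sigma']
  simpa only [sq_abs] using
    sum_sq_le_sq_sum_of_nonneg (s := A.sigma out) (f := fun p => |x p.1 p.2|)
      fun _ _ => abs_nonneg _

lemma fdyn_nonneg {L : Type*} [Fintype L] [DecidableEq L] {Lentry Lint : Finset L}
    {out : L → Finset L} (hout : ∀ k i, i ∈ out k → k ∈ Lentry ∪ Lint)
    {x S C R : L → L → ℝ} {lam : L → ℝ} (hS : ∀ i j, 0 ≤ S i j)
    (hC : ∀ i ∈ Lentry ∪ Lint, ∀ j ∈ out i, 0 ≤ C i j) (hlam : ∀ i ∈ Lentry, 0 ≤ lam i)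
    (hR : ∀ i ∈ Lentry ∪ Lint, ∀ j ∈ out i, 0 ≤ R i j)
    (hx : ∀ i ∈ Lentry ∪ Lint, ∀ j ∈ out i, 0 ≤ x i j) :
    ∀ i ∈ Lentry ∪ Lint, ∀ j ∈ out i, 0 ≤ fdyn Lint out x S C R lam i j := by
  intro i hi j hj
  have hRij := hR i hi j hj
  unfold fdyn
  split_ifs with h
  · refine add_nonneg (le_max_right _ _) (sum_nonneg fun k hk => mul_nonneg hRij ?_)
    have hik : i ∈ out k := (mem_filter.1 hk).2
    have hkL := hout k i hik
    exact le_min (mul_nonneg (hC k hkL i hik) (hS k i)) (hx k hkL i hik)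
  · have hi' : i ∈ Lentry := (mem_union.1 hi).resolve_right h
    exact add_nonneg (le_max_right _ _) (mul_nonneg hRij (hlam i hi'))

/-- Up to terms independent of the signal, `Vcost` is within a uniform constant of the squared norm
of the next state. -/
lemma abs_norm2sq_fdyn_sub_Vcost_le {L : Type*} [Fintype L] [DecidableEq L]
    {Lentry Lint : Finset L} {out : L → Finset L} (hdisj : Disjoint Lentry Lint) (eps : ℝ)
    {x S C R : L → L → ℝ} {lam : L → ℝ} (hS : ∀ i j, S i j ∈ Set.Icc (0 : ℝ) 1)
    (hC : ∀ i ∈ Lentry ∪ Lint, ∀ j ∈ out i, 0 ≤ C i j) (hlam : ∀ i ∈ Lentry, 0 ≤ lam i)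
    (hR : ∀ i ∈ Lentry ∪ Lint, ∀ j ∈ out i, 0 ≤ R i j)
    (hx : ∀ i ∈ Lentry ∪ Lint, ∀ j ∈ out i, 0 ≤ x i j) :
    |norm2sq (Lentry ∪ Lint) out (fdyn Lint out x S C R lam) -
        (Vcost Lentry Lint out eps x S C R lam - eps * norm1 (Lentry ∪ Lint) out x -
          ∑ i ∈ Lentry, lam i ^ 2)| ≤
      ∑ i ∈ Lentry, ∑ j ∈ out i, (R i j * lam i + C i j) ^ 2 := by
  have hsplit : norm2sq (Lentry ∪ Lint) out (fdyn Lint out x S C R lam) -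
        (Vcost Lentry Lint out eps x S C R lam - eps * norm1 (Lentry ∪ Lint) out x -
          ∑ i ∈ Lentry, lam i ^ 2) =
      ∑ i ∈ Lentry, ∑ j ∈ out i, (fdyn Lint out x S C R lam i j ^ 2 -
        (x i j ^ 2 + 2 * R i j * lam i * x i j + C i j ^ 2 * S i j ^ 2
          - 2 * C i j * S i j * x i j)) := by
    unfold norm2sq Vcost
    rw [sum_union hdisj]
    simp_rw [sum_sub_distrib]
    ring
  rw [hsplit]
  refine (abs_sum_le_sum_abs _ _).trans (sum_le_sum fun i hi => ?_)
  refine (abs_sum_le_sum_abs _ _).trans (sum_le_sum fun j hj => ?_)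
  have hi' := mem_union_left Lint hi
  have hCij := hC i hi' j hj
  have key := abs_sq_max_sub_add_sub_le (hx i hi' j hj) (mul_nonneg hCij (hS i j).1)
    (mul_le_of_le_one_right hCij (hS i j).2) (mul_nonneg (hR i hi' j hj) (hlam i hi))
  rw [fdyn, if_neg (disjoint_left.1 hdisj hi)]
  refine le_of_eq_of_le (congrArg abs ?_) key
  ring

/-- input-to-state practical stability of the closed loop under the
one-step MPC policy, given the max-pressure drift property. -/
theorem closed_loop_ISpS {L : Type*} [Fintype L] [DecidableEq L]
    (Lentry Lint : Finset L) (out : L → Finset L)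
    (hout : ∀ k i, i ∈ out k → k ∈ Lentry ∪ Lint)
    (hdisj : Disjoint Lentry Lint)
    (𝒮 : Set (L → L → ℝ)) (hne : 𝒮.Nonempty) (hcomp : IsCompact 𝒮)
    (hSmem : ∀ S ∈ 𝒮, ∀ i j, S i j ∈ Set.Icc (0 : ℝ) 1)
    (C R : L → L → ℝ) (lam : L → ℝ) (eps k : ℝ) (heps : 0 < eps) (hk : 0 ≤ k)
    (hC : ∀ i ∈ Lentry ∪ Lint, ∀ j ∈ out i, 0 ≤ C i j)
    (hlam : ∀ i ∈ Lentry, 0 ≤ lam i)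
    (hR : ∀ i ∈ Lentry ∪ Lint, ∀ j ∈ out i, 0 ≤ R i j)
    (hRsum : ∀ i ∈ Lentry ∪ Lint, ∑ j ∈ out i, R i j ≤ 1)
    (Smp : (L → L → ℝ) → (L → L → ℝ))
    (hmp : ∀ y : L → L → ℝ, (∀ i ∈ Lentry ∪ Lint, ∀ j ∈ out i, 0 ≤ y i j) →
      Smp y ∈ 𝒮 ∧
      norm2sq (Lentry ∪ Lint) out (fdyn Lint out y (Smp y) C R lam)
          - norm2sq (Lentry ∪ Lint) out y
        ≤ -eps * norm1 (Lentry ∪ Lint) out y + k)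
    (π : (L → L → ℝ) → (L → L → ℝ))
    (hπ : ∀ y : L → L → ℝ, (∀ i ∈ Lentry ∪ Lint, ∀ j ∈ out i, 0 ≤ y i j) →
      π y ∈ 𝒮 ∧ ∀ S ∈ 𝒮, Vcost Lentry Lint out eps y (π y) C R lam ≤
        Vcost Lentry Lint out eps y S C R lam)
    (traj : (L → L → ℝ) → ℕ → (L → L → ℝ))
    (htraj0 : ∀ x0, traj x0 0 = x0)
    (htraj : ∀ x0 t,
      traj x0 (t + 1) = fdyn Lint out (traj x0 t) (π (traj x0 t)) C R lam) :
    ∃ (β : ℝ → ℕ → ℝ) (d : ℝ), IsClassKL β ∧ 0 ≤ d ∧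
      ∀ x0 : L → L → ℝ, (∀ i ∈ Lentry ∪ Lint, ∀ j ∈ out i, 0 ≤ x0 i j) →
        ∀ t, norm2 (Lentry ∪ Lint) out (traj x0 t) ≤
          β (norm2 (Lentry ∪ Lint) out x0) t + d := by
  set K := ∑ i ∈ Lentry, ∑ j ∈ out i, (R i j * lam i + C i j) ^ 2
  have hK : 0 ≤ K := sum_nonneg fun _ _ => sum_nonneg fun _ _ => sq_nonneg _
  obtain ⟨d, hd, hbound⟩ := exists_le_max_of_sq_drift heps (by positivity : 0 ≤ k + 2 * K)
  refine ⟨_, d, isClassKL_max_sub_add_div (δ := eps / 4) (by positivity), hd,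
    fun x0 hx0 t => ?_⟩
  have hpos : ∀ t, ∀ i ∈ Lentry ∪ Lint, ∀ j ∈ out i, 0 ≤ traj x0 t i j := by
    intro t
    induction t with
    | zero => simpa only [htraj0] using hx0
    | succ t ih =>
      rw [htraj]
      exact fdyn_nonneg hout (fun i j => (hSmem _ (hπ _ ih).1 i j).1) hC hlam hR ih
  have hstep : ∀ t, norm2 (Lentry ∪ Lint) out (traj x0 (t + 1)) ^ 2 ≤
      norm2 (Lentry ∪ Lint) out (traj x0 t) ^ 2 - eps * norm2 (Lentry ∪ Lint) out (traj x0 t)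
        + (k + 2 * K) := by
    intro t
    have hy := hpos t
    rw [htraj]
    set y := traj x0 t
    obtain ⟨hmem, hdrift⟩ := hmp y hy
    obtain ⟨hπmem, hmin⟩ := hπ y hy
    have h1 := abs_le.1 (abs_norm2sq_fdyn_sub_Vcost_le hdisj eps (hSmem _ hπmem) hC hlam hR hy)
    have h2 := abs_le.1 (abs_norm2sq_fdyn_sub_Vcost_le hdisj eps (hSmem _ hmem) hC hlam hR hy)
    have h3 := mul_le_mul_of_nonneg_left (norm2_le_norm1 (Lentry ∪ Lint) out y) heps.le
    have h4 : ∀ z, norm2 (Lentry ∪ Lint) out z ^ 2 = norm2sq (Lentry ∪ Lint) out z :=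
      fun z => Real.sq_sqrt (norm2sq_nonneg _ _ z)
    rw [h4, h4]
    linarith [hmin _ hmem, h1.2, h2.1]
  have h := hbound (fun t => norm2 (Lentry ∪ Lint) out (traj x0 t))
    (fun _ => Real.sqrt_nonneg _) hstep t
  simp only [htraj0] at h
  have hs : 0 ≤ norm2 (Lentry ∪ Lint) out x0 / ((t : ℝ) + 1) :=
    div_nonneg (Real.sqrt_nonneg _) (by positivity)
  refine h.trans (max_le ?_ ?_)
  · linarith [le_max_left (norm2 (Lentry ∪ Lint) out x0 - eps / 4 * t) 0]
  · linarith [le_max_right (norm2 (Lentry ∪ Lint) out x0 - eps / 4 * t) 0]
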